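/- Fix t > 0, r > 0, η ≥ 8qr/t and R > 2ηt/q. There exists T₀ > e (depending only on d, α, t, r, η, R) such that for every T ≥ T₀ the following holds: if a potential ξ_T : L_T → (0,∞) satisfies (A) there exists x ∈ L_T(0,r) with η ≤ ξ_T(x) < 2η, (B) ξ_T(y) ≤ η/2 for every y ∈ L_T(0,R) \ {x}, and (C) h_T(z) ≤ t/8 for every z ∈ L_T(0,r), then: for every z ∈ L_T with h_T(z) ≤ t one has m_T(z,t) = ξ_T(x)·(t − h_T(x)) − q|z − x| = m_T(x,t) − q|z − x|, and for every z ∈ L_T with h_T(z) > t one has m_T(z,t) = 0. In particular x is the unique maximizer of z ↦ m_T(z,t) on L_T. -/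

import Mathlib

open MeasureTheory ProbabilityTheory Real

noncomputable section

/-- The ℓ¹-norm on `ℝ^d`. -/
def l1 {d : ℕ} (z : Fin d → ℝ) : ℝ := ∑ i, |z i|

/-- Membership in the rescaled lattice `L_T = {z ∈ ℝ^d : r(T) z ∈ ℤ^d}`. -/
def inLatt {d : ℕ} (rT : ℝ) (z : Fin d → ℝ) : Prop := ∀ i, ∃ m : ℤ, rT * z i = (m : ℝ)

/-- The rescaled potential `ξ_T(z) = ξ(r(T) z) / a(T)` built from the environment `ξ` on `ℤ^d`. -/
def envPot {Ω : Type*} {d : ℕ} (aT rT : ℝ) (ξ : (Fin d → ℤ) → Ω → ℝ) (ω : Ω)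
    (z : Fin d → ℝ) : ℝ :=
  ξ (fun i => ⌊rT * z i⌋) ω / aT

/-- The cost `∑_{j=1}^n q|y_{j-1} - y_j| / ξ_T(y_j)` of the path `y 0, …, y n`. -/
def pathCost {d : ℕ} (q : ℝ) (ξT : (Fin d → ℝ) → ℝ) (n : ℕ) (y : ℕ → Fin d → ℝ) : ℝ :=
  ∑ j ∈ Finset.range n, q * l1 (y j - y (j + 1)) / ξT (y (j + 1))

/-- The lilypad hitting time `h_T(z)`. -/
def hitTime {d : ℕ} (q rT : ℝ) (ξT : (Fin d → ℝ) → ℝ) (z : Fin d → ℝ) : ℝ :=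
  sInf {s : ℝ | ∃ n : ℕ, 1 ≤ n ∧ ∃ y : ℕ → Fin d → ℝ,
    (∀ j ≤ n, inLatt rT (y j)) ∧ y 0 = z ∧ y n = 0 ∧ s = pathCost q ξT n y}

/-- The rounding `[x]_T` of `x ∈ ℝ^d` to the lattice `L_T`. -/
def roundT {d : ℕ} (rT : ℝ) (x : Fin d → ℝ) : Fin d → ℝ := fun i => (⌊rT * x i⌋ : ℝ) / rT

/-- The PAM lilypad hitting time `τ_T(z) = inf_y q(|y| + |z-y|)/ξ_T(y)`. -/
def tauT {d : ℕ} (q rT : ℝ) (ξT : (Fin d → ℝ) → ℝ) (z : Fin d → ℝ) : ℝ :=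
  sInf {s : ℝ | ∃ y : Fin d → ℝ, inLatt rT y ∧ s = q * (l1 y + l1 (z - y)) / ξT y}

/-- The BRW lilypad profile `m_T(z,t) = sup_y { ξ_T(y)(t - h_T(y))_+ - q|z-y| }`. -/
def mT {d : ℕ} (q rT : ℝ) (ξT : (Fin d → ℝ) → ℝ) (z : Fin d → ℝ) (t : ℝ) : ℝ :=
  sSup {v : ℝ | ∃ y : Fin d → ℝ, inLatt rT y ∧
    v = ξT y * max (t - hitTime q rT ξT y) 0 - q * l1 (z - y)}

/-- The PAM lilypad profile `λ_T(z,t) = sup_y { ξ_T(y) t - q|y| - q|z-y| } ∨ 0`. -/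
def lamT {d : ℕ} (q rT : ℝ) (ξT : (Fin d → ℝ) → ℝ) (z : Fin d → ℝ) (t : ℝ) : ℝ :=
  max (sSup {v : ℝ | ∃ y : Fin d → ℝ, inLatt rT y ∧
    v = ξT y * t - q * l1 y - q * l1 (z - y)}) 0

/-- `a(T) = (T / log T)^q`. -/
def aOf (q T : ℝ) : ℝ := (T / Real.log T) ^ q

/-- `r(T) = (T / log T)^(q+1)`. -/
def rOf (q T : ℝ) : ℝ := (T / Real.log T) ^ (q + 1)

end

/-! ### The `ℓ¹`-norm and the lattice -/

theorem l1_nonneg {d : ℕ} (z : Fin d → ℝ) : 0 ≤ l1 z :=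
  Finset.sum_nonneg fun _ _ => abs_nonneg _

theorem l1_zero {d : ℕ} : l1 (0 : Fin d → ℝ) = 0 := by simp [l1]

theorem l1_sub_comm {d : ℕ} (z w : Fin d → ℝ) : l1 (z - w) = l1 (w - z) :=
  Finset.sum_congr rfl fun i _ => abs_sub_comm (z i) (w i)

theorem l1_sub_le {d : ℕ} (u v w : Fin d → ℝ) : l1 (u - w) ≤ l1 (u - v) + l1 (v - w) := by
  unfold l1
  rw [← Finset.sum_add_distrib]
  exact Finset.sum_le_sum fun i _ => abs_sub_le (u i) (v i) (w i)

theorem l1_le_sub_add {d : ℕ} (z w : Fin d → ℝ) : l1 z ≤ l1 (z - w) + l1 w := by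
  simpa using l1_sub_le z w 0

theorem l1_sub_le_add {d : ℕ} (z w : Fin d → ℝ) : l1 (z - w) ≤ l1 z + l1 w := by
  have h := l1_sub_le z 0 w
  rwa [l1_sub_comm 0 w, sub_zero, sub_zero] at h

theorem l1_sub_pos {d : ℕ} {z w : Fin d → ℝ} (h : z ≠ w) : 0 < l1 (z - w) := by
  obtain ⟨i, hi⟩ := Function.ne_iff.mp h
  exact Finset.sum_pos' (fun _ _ => abs_nonneg _)
    ⟨i, Finset.mem_univ i, abs_pos.mpr (sub_ne_zero.mpr hi)⟩

theorem inLatt_zero {d : ℕ} (ρ : ℝ) : inLatt ρ (0 : Fin d → ℝ) := fun _ => ⟨0, by simp⟩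

/-! ### Path costs and the hitting time -/

theorem pathCost_succ {d : ℕ} (q : ℝ) (ξ : (Fin d → ℝ) → ℝ) (n : ℕ) (y : ℕ → Fin d → ℝ) :
    pathCost q ξ (n + 1) y
      = q * l1 (y 0 - y 1) / ξ (y 1) + pathCost q ξ n (fun j => y (j + 1)) := by
  rw [pathCost, Finset.sum_range_succ', add_comm]
  rfl

theorem pathCost_nonneg {d : ℕ} {q ρ : ℝ} {ξ : (Fin d → ℝ) → ℝ} (hq : 0 ≤ q)
    (hξ : ∀ z, inLatt ρ z → 0 < ξ z) {n : ℕ} {y : ℕ → Fin d → ℝ}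
    (hy : ∀ j ≤ n, inLatt ρ (y j)) : 0 ≤ pathCost q ξ n y :=
  Finset.sum_nonneg fun _ hj =>
    div_nonneg (mul_nonneg hq (l1_nonneg _)) (hξ _ (hy _ (Finset.mem_range.mp hj))).le

theorem hitTime_le_pathCost {d : ℕ} {q ρ : ℝ} {ξ : (Fin d → ℝ) → ℝ} (hq : 0 ≤ q)
    (hξ : ∀ z, inLatt ρ z → 0 < ξ z) {n : ℕ} (hn : 1 ≤ n) {y : ℕ → Fin d → ℝ}
    (hy : ∀ j ≤ n, inLatt ρ (y j)) (hyn : y n = 0) :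
    hitTime q ρ ξ (y 0) ≤ pathCost q ξ n y := by
  refine csInf_le ⟨0, ?_⟩ ⟨n, hn, y, hy, rfl, hyn, rfl⟩
  rintro s ⟨n, -, y, hy, -, -, rfl⟩
  exact pathCost_nonneg hq hξ hy

theorem hitTime_zero_le {d : ℕ} {q ρ : ℝ} {ξ : (Fin d → ℝ) → ℝ} (hq : 0 ≤ q)
    (hξ : ∀ z, inLatt ρ z → 0 < ξ z) : hitTime q ρ ξ 0 ≤ 0 := by
  have h := hitTime_le_pathCost hq hξ le_rfl (y := fun _ => 0) (fun _ _ => inLatt_zero ρ) rfl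
  simpa [pathCost, l1_zero] using h

theorem le_hitTime {d : ℕ} {q ρ : ℝ} {ξ : (Fin d → ℝ) → ℝ} {z : Fin d → ℝ} {c : ℝ}
    (hz : inLatt ρ z)
    (h : ∀ n : ℕ, 1 ≤ n → ∀ y : ℕ → Fin d → ℝ, (∀ j ≤ n, inLatt ρ (y j)) → y 0 = z → y n = 0 →
      c ≤ pathCost q ξ n y) : c ≤ hitTime q ρ ξ z := by
  refine le_csInf ?_ ?_
  · refine ⟨_, 1, le_rfl, fun j => if j = 0 then z else 0, fun _ _ => ?_, rfl, rfl, rfl⟩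
    dsimp only
    split_ifs
    exacts [hz, inLatt_zero ρ]
  · rintro s ⟨n, hn, y, hy, hy0, hyn, rfl⟩
    exact h n hn y hy hy0 hyn

/-- The hitting time at `z` is at most the cost of a jump to `w` plus the hitting time at `w`. -/
theorem hitTime_le_jump_add {d : ℕ} {q ρ : ℝ} {ξ : (Fin d → ℝ) → ℝ} (hq : 0 ≤ q)
    (hξ : ∀ z, inLatt ρ z → 0 < ξ z) {z w : Fin d → ℝ} (hz : inLatt ρ z) (hw : inLatt ρ w) :
    hitTime q ρ ξ z ≤ q * l1 (z - w) / ξ w + hitTime q ρ ξ w := by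
  rw [← sub_le_iff_le_add']
  refine le_hitTime hw fun n _ y hy hy0 hyn => ?_
  have h := hitTime_le_pathCost hq hξ (n := n + 1) (by omega)
    (y := fun j => Nat.casesOn j z y) (by rintro (_ | j) hj; exacts [hz, hy j (by omega)]) hyn
  rw [pathCost_succ] at h
  change hitTime q ρ ξ z ≤ q * l1 (z - y 0) / ξ (y 0) + pathCost q ξ n y at h
  rw [hy0] at h
  linarith

/-- Comparison principle: a function that vanishes at the origin and obeys the jump inequality,
possibly with help from the hitting time itself, is a lower bound for the hitting time. -/
theorem le_hitTime_of_jump_le {d : ℕ} {q ρ : ℝ} {ξ : (Fin d → ℝ) → ℝ} (hq : 0 ≤ q)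
    (hξ : ∀ z, inLatt ρ z → 0 < ξ z) {F : (Fin d → ℝ) → ℝ} (hF0 : F 0 ≤ 0)
    (hF : ∀ z w, inLatt ρ z → inLatt ρ w →
      F z ≤ q * l1 (z - w) / ξ w + max (F w) (hitTime q ρ ξ w))
    {z : Fin d → ℝ} (hz : inLatt ρ z) : F z ≤ hitTime q ρ ξ z := by
  have key : ∀ n : ℕ, ∀ y : ℕ → Fin d → ℝ, (∀ j ≤ n, inLatt ρ (y j)) → y n = 0 →
      F (y 0) ≤ pathCost q ξ n y := by
    intro n
    induction n with
    | zero =>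
      intro y _ hyn
      simpa [pathCost, hyn] using hF0
    | succ n ih =>
      intro y hy hyn
      have htail : ∀ j ≤ n, inLatt ρ (y (j + 1)) := fun j hj => hy (j + 1) (by omega)
      have h1 := ih (fun j => y (j + 1)) htail hyn
      have h2 : hitTime q ρ ξ (y 1) ≤ pathCost q ξ n (fun j => y (j + 1)) := by
        rcases Nat.eq_zero_or_pos n with rfl | hn
        · rw [hyn]
          simpa [pathCost] using hitTime_zero_le hq hξ
        · exact hitTime_le_pathCost hq hξ hn htail hyn
      rw [pathCost_succ]
      exact (hF _ _ (hy 0 (by omega)) (hy 1 (by omega))).trans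
        (add_le_add_right (max_le h1 h2) _)
  exact le_hitTime hz fun n _ y hy hy0 hyn => hy0 ▸ key n y hy hyn

/-- If the potential is at most `M` on the ball of radius `R`, then growing from the origin to
distance `min |z| R` takes time at least `q (min |z| R) / M`. -/
theorem mul_min_div_le_hitTime {d : ℕ} {q ρ M R : ℝ} {ξ : (Fin d → ℝ) → ℝ} (hq : 0 ≤ q)
    (hM : 0 < M) (hξ : ∀ z, inLatt ρ z → 0 < ξ z)
    (hξM : ∀ z, inLatt ρ z → l1 z < R → ξ z ≤ M) {z : Fin d → ℝ} (hz : inLatt ρ z) :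
    q * min (l1 z) R / M ≤ hitTime q ρ ξ z := by
  refine le_hitTime_of_jump_le (F := fun z => q * min (l1 z) R / M) hq hξ ?_ ?_ hz
  · rw [l1_zero]
    exact div_nonpos_of_nonpos_of_nonneg
      (mul_nonpos_of_nonneg_of_nonpos hq (min_le_left _ _)) hM.le
  · intro z w _ hw
    refine le_trans ?_ (add_le_add_right (le_max_left _ _) _)
    have hjump : 0 ≤ q * l1 (z - w) := mul_nonneg hq (l1_nonneg _)
    rcases lt_or_ge (l1 w) R with hwR | hwR
    · have h1 : q * l1 (z - w) / M ≤ q * l1 (z - w) / ξ w :=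
        div_le_div_of_nonneg_left hjump (hξ w hw) (hξM w hw hwR)
      have h2 : q * min (l1 z) R / M ≤ q * l1 (z - w) / M + q * min (l1 w) R / M := by
        rw [← add_div, ← mul_add, min_eq_left hwR.le]
        gcongr
        exact (min_le_left _ _).trans (l1_le_sub_add z w)
      linarith
    · have h1 : 0 ≤ q * l1 (z - w) / ξ w := div_nonneg hjump (hξ w hw).le
      have h2 : q * min (l1 z) R / M ≤ q * min (l1 w) R / M := by
        rw [min_eq_right hwR]
        gcongr
        exact min_le_right _ _
      linarith

/-- Away from a dominating site `x`, a path to the origin either leaves the ball of radius `R`,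
or avoids `x` and is slow, or passes through `x`. -/
theorem min_le_hitTime_of_peak {d : ℕ} {q ρ η R : ℝ} {ξ : (Fin d → ℝ) → ℝ} (hq : 0 ≤ q)
    (hη : 0 < η) (hξ : ∀ z, inLatt ρ z → 0 < ξ z) {x : Fin d → ℝ} (hx : inLatt ρ x)
    (hxR : l1 x ≤ R) (hηx : η ≤ ξ x)
    (hξη : ∀ y, inLatt ρ y → l1 y < R → y ≠ x → ξ y ≤ η / 2)
    {z : Fin d → ℝ} (hz : inLatt ρ z) :
    min (q * R / ξ x) (min (q * l1 z / (η / 2)) (q * l1 (z - x) / ξ x + hitTime q ρ ξ x))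
      ≤ hitTime q ρ ξ z := by
  have hX : 0 < ξ x := hξ x hx
  have hhx : q * l1 x / ξ x ≤ hitTime q ρ ξ x := by
    have h := mul_min_div_le_hitTime (R := R) hq hX hξ (fun y hy hyR => by
      by_cases hyx : y = x
      · rw [hyx]
      · linarith [hξη y hy hyR hyx]) hx
    rwa [min_eq_left hxR] at h
  refine le_hitTime_of_jump_le (F := fun z => min (q * R / ξ x)
    (min (q * l1 z / (η / 2)) (q * l1 (z - x) / ξ x + hitTime q ρ ξ x))) hq hξ ?_ ?_ hz
  · refine (min_le_right _ _).trans ((min_le_left _ _).trans ?_)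
    simp [l1_zero]
  · intro z w hz hw
    have hjump : 0 ≤ q * l1 (z - w) := mul_nonneg hq (l1_nonneg _)
    by_cases hwx : w = x
    · subst hwx
      exact (min_le_right _ _).trans ((min_le_right _ _).trans
        (add_le_add_right (le_max_right _ _) _))
    refine le_trans ?_ (add_le_add_right (le_max_left _ _) _)
    rcases lt_or_ge (l1 w) R with hwR | hwR
    · have hwη := hξη w hw hwR hwx
      have h1 : q * l1 (z - w) / (η / 2) ≤ q * l1 (z - w) / ξ w :=
        div_le_div_of_nonneg_left hjump (hξ w hw) hwη
      have h2 : q * l1 (z - w) / ξ x ≤ q * l1 (z - w) / ξ w :=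
        div_le_div_of_nonneg_left hjump (hξ w hw) (by linarith)
      have h3 : q * l1 z / (η / 2) ≤ q * l1 (z - w) / (η / 2) + q * l1 w / (η / 2) := by
        rw [← add_div, ← mul_add]
        gcongr
        exact l1_le_sub_add z w
      have h4 : q * l1 (z - x) / ξ x ≤ q * l1 (z - w) / ξ x + q * l1 (w - x) / ξ x := by
        rw [← add_div, ← mul_add]
        gcongr
        exact l1_sub_le z w x
      have h5 : 0 ≤ q * l1 (z - w) / ξ w := div_nonneg hjump (hξ w hw).le
      rw [← min_add_add_left, ← min_add_add_left]
      exact min_le_min (by linarith) (min_le_min (by linarith) (by linarith))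
    · have h1 : 0 ≤ q * l1 (z - w) / ξ w := div_nonneg hjump (hξ w hw).le
      have h2 : q * R / ξ x ≤ q * l1 w / (η / 2) :=
        div_le_div₀ (mul_nonneg hq (l1_nonneg _)) (by gcongr) (by linarith) (by linarith)
      have h3 : q * R / ξ x ≤ q * l1 (w - x) / ξ x + hitTime q ρ ξ x := by
        have h : q * R / ξ x ≤ q * l1 (w - x) / ξ x + q * l1 x / ξ x := by
          rw [← add_div, ← mul_add]
          gcongr
          exact hwR.trans (l1_le_sub_add w x)
        linarith
      calc _ ≤ q * R / ξ x := min_le_left _ _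
        _ ≤ _ := le_min le_rfl (le_min h2 h3)
        _ ≤ _ := le_add_of_nonneg_left h1

/-! ### The lilypad profile -/

/-- The lilypad profile vanishes at sites that have not been hit. -/
theorem mT_eq_zero_of_lt_hitTime {d : ℕ} {q ρ t : ℝ} {ξ : (Fin d → ℝ) → ℝ} (hq : 0 ≤ q)
    (hξ : ∀ z, inLatt ρ z → 0 < ξ z) {z : Fin d → ℝ} (hz : inLatt ρ z)
    (hzt : t < hitTime q ρ ξ z) : mT q ρ ξ z t = 0 := by
  refine IsGreatest.csSup_eq ⟨⟨z, hz, ?_⟩, ?_⟩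
  · rw [max_eq_right (by linarith), sub_self, l1_zero]
    ring
  · rintro v ⟨y, hy, rfl⟩
    have hY := hξ y hy
    have h := hitTime_le_jump_add hq hξ hz hy
    have h1 : max (t - hitTime q ρ ξ y) 0 ≤ q * l1 (z - y) / ξ y :=
      max_le (by linarith) (div_nonneg (mul_nonneg hq (l1_nonneg _)) hY.le)
    rw [le_div_iff₀' hY] at h1
    linarith

/-- If the site `x` has been hit by time `t`, is worth more than any other hit site even after
paying for the distance, and its lilypad covers `z`, then the profile at `z` comes from `x`. -/
theorem mT_eq_of_dominating {d : ℕ} {q ρ t : ℝ} {ξ : (Fin d → ℝ) → ℝ} (hq : 0 ≤ q)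
    {x z : Fin d → ℝ} (hx : inLatt ρ x) (hxt : hitTime q ρ ξ x ≤ t)
    (hdom : ∀ y, inLatt ρ y → hitTime q ρ ξ y ≤ t →
      ξ y * (t - hitTime q ρ ξ y) + q * l1 (y - x) ≤ ξ x * (t - hitTime q ρ ξ x))
    (hcov : q * l1 (z - x) ≤ ξ x * (t - hitTime q ρ ξ x)) :
    mT q ρ ξ z t = ξ x * (t - hitTime q ρ ξ x) - q * l1 (z - x) := by
  refine IsGreatest.csSup_eq ⟨⟨x, hx, ?_⟩, ?_⟩
  · rw [max_eq_left (by linarith)]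
  · rintro v ⟨y, hy, rfl⟩
    rcases le_total (hitTime q ρ ξ y) t with hyt | hyt
    · rw [max_eq_left (by linarith)]
      have h := mul_le_mul_of_nonneg_left (l1_sub_le z y x) hq
      linarith [hdom y hy hyt]
    · rw [max_eq_right (by linarith)]
      have h := mul_nonneg hq (l1_nonneg (z - y))
      linarith

/-- **Proposition 8.1.** Under assumptions (A), (B), (C), for large `T`: if `h_T(z) ≤ t`
then `m_T(z,t) = m_T(x,t) − q|z−x| = ξ_T(x)(t − h_T(x)) − q|z−x|`, and otherwise
`m_T(z,t) = 0`. In particular `x` is the unique maximizer of `m_T(·,t)`. -/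
theorem brw_lilypad_peak
    (d : ℕ) (hd : 1 ≤ d) (α : ℝ) (hα : (d : ℝ) < α)
    (q : ℝ) (hq : q = d / (α - d))
    (t r η R : ℝ) (ht : 0 < t) (hr : 0 < r)
    (hη : 8 * q * r / t ≤ η) (hR : 2 * η * t / q < R) :
    ∃ T₀ : ℝ, Real.exp 1 < T₀ ∧ ∀ T : ℝ, T₀ ≤ T →
      ∀ ξT : (Fin d → ℝ) → ℝ, (∀ z, inLatt (rOf q T) z → 0 < ξT z) →
      ∀ x : Fin d → ℝ, inLatt (rOf q T) x → l1 x < r → η ≤ ξT x → ξT x < 2 * η →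
      (∀ y, inLatt (rOf q T) y → l1 y < R → y ≠ x → ξT y ≤ η / 2) →
      (∀ z, inLatt (rOf q T) z → l1 z < r → hitTime q (rOf q T) ξT z ≤ t / 8) →
      (∀ z, inLatt (rOf q T) z →
        (hitTime q (rOf q T) ξT z ≤ t →
          mT q (rOf q T) ξT z t
              = ξT x * (t - hitTime q (rOf q T) ξT x) - q * l1 (z - x) ∧
          mT q (rOf q T) ξT z t = mT q (rOf q T) ξT x t - q * l1 (z - x)) ∧
        (t < hitTime q (rOf q T) ξT z → mT q (rOf q T) ξT z t = 0))
      ∧ (∀ z, inLatt (rOf q T) z → z ≠ x →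
          mT q (rOf q T) ξT z t < mT q (rOf q T) ξT x t) := by
  have hq0 : 0 < q := by
    rw [hq]
    exact div_pos (by exact_mod_cast hd) (by linarith)
  have hη0 : 0 < η := lt_of_lt_of_le (by positivity) hη
  have hqr : 8 * q * r ≤ η * t := by rwa [div_le_iff₀ ht] at hη
  have hRt : 2 * η * t < R * q := by rwa [div_lt_iff₀ hq0] at hR
  have hrR : r < R := by
    refine lt_of_mul_lt_mul_left ?_ hq0.le
    nlinarith [mul_pos hq0 hr]
  refine ⟨Real.exp 1 + 1, by linarith, fun T _ ξ hξ x hx hxr hηx hxη hξη hC => ?_⟩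
  generalize rOf q T = ρ at *
  have hX : 0 < ξ x := by linarith
  have hhx := hC x hx hxr
  have hpeak : η * t * (7 / 8) ≤ ξ x * (t - hitTime q ρ ξ x) := by
    have h1 : η * (t - t / 8) ≤ ξ x * (t - hitTime q ρ ξ x) :=
      mul_le_mul hηx (by linarith) (by linarith) hX.le
    linarith
  have hpos : 0 < η * t := mul_pos hη0 ht
  have hqx : q * l1 x ≤ η * t / 8 := by
    have := mul_le_mul_of_nonneg_left hxr.le hq0.le
    linarith
  have htR : t < q * R / ξ x := by
    rw [lt_div_iff₀ hX]
    nlinarith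
  have hdom : ∀ y, inLatt ρ y → hitTime q ρ ξ y ≤ t →
      ξ y * (t - hitTime q ρ ξ y) + q * l1 (y - x) ≤ ξ x * (t - hitTime q ρ ξ x) := by
    intro y hy hyt
    by_cases hyx : y = x
    · simp [hyx, l1_zero]
    have hyR : l1 y < R := by
      by_contra! hyR
      have h := mul_min_div_le_hitTime (R := R) hq0.le hX hξ (fun w hw hwR => by
        by_cases hwx : w = x
        · rw [hwx]
        · linarith [hξη w hw hwR hwx]) hy
      rw [min_eq_right hyR] at h
      linarith
    have hyη := hξη y hy hyR hyx
    have h := min_le_hitTime_of_peak hq0.le hη0 hξ hx (hxr.trans hrR).le hηx hξη hy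
    rcases min_le_iff.mp h with h | h
    · linarith
    rcases min_le_iff.mp h with h | h
    · rw [div_le_iff₀ (by linarith)] at h
      have h1 := mul_le_mul_of_nonneg_right hyη (sub_nonneg.mpr hyt)
      have h2 := mul_le_mul_of_nonneg_left (l1_sub_le_add y x) hq0.le
      linarith
    · have h1 := mul_le_mul_of_nonneg_right (show ξ y ≤ ξ x by linarith) (sub_nonneg.mpr hyt)
      rw [← le_sub_iff_add_le, div_le_iff₀' hX] at h
      linarith
  have hcov : ∀ z, inLatt ρ z → hitTime q ρ ξ z ≤ t →
      q * l1 (z - x) ≤ ξ x * (t - hitTime q ρ ξ x) := fun z hz hzt => by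
    have h := mul_nonneg (hξ z hz).le (sub_nonneg.mpr hzt)
    linarith [hdom z hz hzt]
  have hhit : ∀ z, inLatt ρ z → hitTime q ρ ξ z ≤ t →
      mT q ρ ξ z t = ξ x * (t - hitTime q ρ ξ x) - q * l1 (z - x) := fun z hz hzt =>
    mT_eq_of_dominating hq0.le hx (by linarith) hdom (hcov z hz hzt)
  have hmx : mT q ρ ξ x t = ξ x * (t - hitTime q ρ ξ x) := by
    simpa [l1_zero] using hhit x hx (by linarith)
  have hunhit : ∀ z, inLatt ρ z → t < hitTime q ρ ξ z → mT q ρ ξ z t = 0 := fun z hz hzt =>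
    mT_eq_zero_of_lt_hitTime hq0.le hξ hz hzt
  refine ⟨fun z hz => ⟨fun hzt => ⟨hhit z hz hzt, ?_⟩, hunhit z hz⟩, fun z hz hzx => ?_⟩
  · rw [hhit z hz hzt, hmx]
  · rcases le_or_gt (hitTime q ρ ξ z) t with hzt | hzt
    · rw [hhit z hz hzt, hmx]
      linarith [mul_pos hq0 (l1_sub_pos hzx)]
    · rw [hunhit z hz hzt, hmx]
      linarith
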